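/- Let f₁, …, f₅ be Schwartz functions on ℝ. Then the Fourier transform of 𝓣₆(f₁,…,f₅) equals 𝓣₆(𝓕f₁, 𝓕f₂, 𝓕f₃, 𝓕f₄, 𝓕f₅); that is, 𝓕(𝓣₆(f₁,…,f₅))(ξ) = 𝓣₆(𝓕f₁,…,𝓕f₅)(ξ) for all ξ ∈ ℝ. -/

import Mathlib

open MeasureTheory SchwartzMap
open scoped ENNReal ComplexConjugate Real FourierTransform

/-- The quintilinear operator `𝓣₆`, with integration variables `(β, ξ, λ)`. -/
noncomputable def T6 (f₁ f₂ f₃ f₄ f₅ : ℝ → ℂ) (x : ℝ) : ℂ :=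
  ((3 / π ^ 2 : ℝ) : ℂ) *
    ∫ p : ℝ × ℝ × ℝ,
      f₁ (p.1 + p.2.1) * f₂ (p.2.2 * p.1 + x) *
        f₃ (p.2.2 * x + p.2.1 - p.2.2 * p.2.1) *
        conj (f₄ (p.2.2 * p.1 + p.2.1) *
          f₅ (p.1 + p.2.2 * x + p.2.1 - p.2.2 * p.2.1))

section ChangeOfVariables

variable {E : Type*} [NormedAddCommGroup E] [NormedSpace ℝ E] [MeasurableSpace E] [BorelSpace E]
  [FiniteDimensional ℝ E] (μ : Measure E) [μ.IsAddHaarMeasure]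
  {G : Type*} [NormedAddCommGroup G]

theorem LinearMap.measurableEmbedding_of_det_ne_zero {L : E →ₗ[ℝ] E} (hL : LinearMap.det L ≠ 0) :
    MeasurableEmbedding L :=
  (LinearMap.equivOfDetNeZero L hL).toContinuousLinearEquiv.toHomeomorph.measurableEmbedding

theorem integral_comp_linearMap [NormedSpace ℝ G] {L : E →ₗ[ℝ] E} (hL : LinearMap.det L ≠ 0)
    (g : E → G) :
    ∫ x, g (L x) ∂μ = |(LinearMap.det L)⁻¹| • ∫ x, g x ∂μ := by
  rw [← (LinearMap.measurableEmbedding_of_det_ne_zero hL).integral_map,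
    Measure.map_linearMap_addHaar_eq_smul_addHaar μ hL, integral_smul_measure,
    ENNReal.toReal_ofReal (abs_nonneg _)]

theorem integrable_comp_linearMap {L : E →ₗ[ℝ] E} (hL : LinearMap.det L ≠ 0)
    {g : E → G} (hg : Integrable g μ) : Integrable (fun x => g (L x)) μ := by
  have h : Integrable g (Measure.map L μ) := by
    rw [Measure.map_linearMap_addHaar_eq_smul_addHaar μ hL]
    exact hg.smul_measure ENNReal.ofReal_ne_top
  exact ((LinearMap.measurableEmbedding_of_det_ne_zero hL).integrable_map_iff).1 h

end ChangeOfVariables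

theorem sq_sub_self_add_one_pos (l : ℝ) : 0 < l ^ 2 - l + 1 := by nlinarith [sq_nonneg (l - 1 / 2)]

theorem integrable_inv_sq_sub_self_add_one : Integrable fun l : ℝ => (l ^ 2 - l + 1)⁻¹ := by
  refine (integrable_inv_one_add_sq.const_mul 2).mono'
    (Continuous.aestronglyMeasurable (Continuous.inv₀ (by fun_prop)
      fun l => (sq_sub_self_add_one_pos l).ne')) (.of_forall fun l => ?_)
  have h := sq_sub_self_add_one_pos l
  rw [Real.norm_of_nonneg (inv_pos.2 h).le, ← div_eq_mul_inv, inv_eq_one_div,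
    div_le_div_iff₀ h (by positivity)]
  nlinarith [sq_nonneg (l - 1)]

/-- The change of variables sending `(β, ξ)` to the arguments of `f₄` and `f₅` in `T6`
(up to a translation). -/
def planeMap (l : ℝ) : ℝ × ℝ →ₗ[ℝ] ℝ × ℝ where
  toFun p := (l * p.1 + p.2, p.1 + (1 - l) * p.2)
  map_add' p q := by ext <;> simp <;> ring
  map_smul' c p := by ext <;> simp <;> ring

theorem det_planeMap (l : ℝ) : LinearMap.det (planeMap l) = -(l ^ 2 - l + 1) := by
  rw [← LinearMap.det_toMatrix (Module.Basis.finTwoProd ℝ), Matrix.det_fin_two]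
  simp [LinearMap.toMatrix_apply, planeMap]
  ring

/-- The rotation of `ℝ³` sending `(x, y, z)` to the arguments of `f₁`, `f₂`, `f₃` in `T6`, where
`y` and `z` are the arguments of `f₄` and `f₅`. -/
noncomputable def tripleRotation (l : ℝ) : ℝ × ℝ × ℝ →ₗ[ℝ] ℝ × ℝ × ℝ where
  toFun p :=
    ((l * p.2.1 + (1 - l) * p.2.2 + (l ^ 2 - l) * p.1) / (l ^ 2 - l + 1),
      ((l ^ 2 - l) * p.2.1 + l * p.2.2 + (1 - l) * p.1) / (l ^ 2 - l + 1),
      ((1 - l) * p.2.1 + (l ^ 2 - l) * p.2.2 + l * p.1) / (l ^ 2 - l + 1))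
  map_add' p q := by ext <;> simp <;> ring
  map_smul' c p := by ext <;> simp <;> ring

instance : (volume : Measure (ℝ × ℝ × ℝ)).IsAddHaarMeasure :=
  Measure.prod.instIsAddHaarMeasure volume volume

/-- The standard basis of `ℝ × ℝ × ℝ`. -/
noncomputable def basisTriple : Module.Basis (Fin 3) ℝ (ℝ × ℝ × ℝ) :=
  Module.Basis.ofEquivFun
    { toFun := fun p => ![p.1, p.2.1, p.2.2]
      invFun := fun v => (v 0, v 1, v 2)
      map_add' := fun p q => by ext i; fin_cases i <;> simp
      map_smul' := fun c p => by ext i; fin_cases i <;> simp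
      left_inv := fun p => by simp
      right_inv := fun v => by ext i; fin_cases i <;> simp }

theorem det_tripleRotation (l : ℝ) : LinearMap.det (tripleRotation l) = 1 := by
  have h := (sq_sub_self_add_one_pos l).ne'
  rw [← LinearMap.det_toMatrix basisTriple, Matrix.det_fin_three]
  simp [LinearMap.toMatrix_apply, tripleRotation, basisTriple, div_eq_mul_inv]
  have hd := inv_mul_cancel₀ h
  generalize (l ^ 2 - l + 1)⁻¹ = d at hd ⊢
  linear_combination ((d * (l ^ 2 - l + 1)) ^ 2 + d * (l ^ 2 - l + 1) + 1) * hd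

/-- The dot product on `ℝ × ℝ × ℝ`, used as the phase of the Fourier transform. -/
def dotTriple (p q : ℝ × ℝ × ℝ) : ℝ := p.1 * q.1 + p.2.1 * q.2.1 + p.2.2 * q.2.2

theorem dotTriple_tripleRotation (l : ℝ) (p q : ℝ × ℝ × ℝ) :
    dotTriple (tripleRotation l p) (tripleRotation l q) = dotTriple p q := by
  have h := (sq_sub_self_add_one_pos l).ne'
  simp only [dotTriple, tripleRotation, LinearMap.coe_mk, AddHom.coe_mk, div_eq_mul_inv]
  have hd := inv_mul_cancel₀ h
  generalize (l ^ 2 - l + 1)⁻¹ = d at hd ⊢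
  linear_combination
    (p.1 * q.1 + p.2.1 * q.2.1 + p.2.2 * q.2.2) * (d * (l ^ 2 - l + 1) + 1) * hd

theorem continuous_tripleRotation_uncurry :
    Continuous fun r : ℝ × ℝ × ℝ × ℝ => tripleRotation r.1 r.2 := by
  have h : ∀ r : ℝ × ℝ × ℝ × ℝ, r.1 ^ 2 - r.1 + 1 ≠ 0 :=
    fun r => (sq_sub_self_add_one_pos r.1).ne'
  simp only [tripleRotation, LinearMap.coe_mk, AddHom.coe_mk]
  fun_prop (disch := exact h _)

/-- The tensor product of three functions. -/
def tensorTriple (f₁ f₂ f₃ : ℝ → ℂ) (p : ℝ × ℝ × ℝ) : ℂ := f₁ p.1 * f₂ p.2.1 * f₃ p.2.2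

theorem integrable_tensorTriple (f₁ f₂ f₃ : SchwartzMap ℝ ℂ) :
    Integrable (tensorTriple f₁ f₂ f₃) := by
  have h := f₁.integrable (μ := volume) |>.mul_prod
    ((f₂.integrable (μ := volume)).mul_prod (f₃.integrable (μ := volume)))
  exact h.congr (.of_forall fun p => (mul_assoc _ _ _).symm)

theorem continuous_tensorTriple (f₁ f₂ f₃ : SchwartzMap ℝ ℂ) :
    Continuous (tensorTriple f₁ f₂ f₃) := by
  have h₁ := f₁.continuous
  have h₂ := f₂.continuous
  have h₃ := f₃.continuous
  unfold tensorTriple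
  fun_prop

theorem SchwartzMap.exists_norm_le (f : SchwartzMap ℝ ℂ) : ∃ C, 0 ≤ C ∧ ∀ x, ‖f x‖ ≤ C :=
  ⟨‖f.toBoundedContinuousFunction‖, norm_nonneg _, fun x =>
    f.toBoundedContinuousFunction.norm_coe_le_norm x⟩

theorem exists_norm_tensorTriple_le (f₁ f₂ f₃ : SchwartzMap ℝ ℂ) :
    ∃ C, ∀ p, ‖tensorTriple f₁ f₂ f₃ p‖ ≤ C := by
  obtain ⟨C₁, h₁, h₁'⟩ := f₁.exists_norm_le
  obtain ⟨C₂, h₂, h₂'⟩ := f₂.exists_norm_le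
  obtain ⟨C₃, h₃, h₃'⟩ := f₃.exists_norm_le
  refine ⟨C₁ * C₂ * C₃, fun p => ?_⟩
  rw [tensorTriple, norm_mul, norm_mul]
  gcongr <;> simp [*]

theorem integral_tensorTriple (f₁ f₂ f₃ : ℝ → ℂ) :
    ∫ p, tensorTriple f₁ f₂ f₃ p = (∫ x, f₁ x) * (∫ x, f₂ x) * ∫ x, f₃ x := by
  simp only [tensorTriple, mul_assoc]
  rw [← integral_prod_mul f₂ f₃]
  exact integral_prod_mul f₁ fun q : ℝ × ℝ => f₂ q.1 * f₃ q.2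

theorem integral_fourierChar_mul_tensorTriple (f₁ f₂ f₃ : ℝ → ℂ) (w : ℝ × ℝ × ℝ) :
    ∫ p, (𝐞 (-dotTriple p w) : ℂ) * tensorTriple f₁ f₂ f₃ p
      = tensorTriple (𝓕 f₁) (𝓕 f₂) (𝓕 f₃) w := by
  rw [tensorTriple, Real.fourier_real_eq, Real.fourier_real_eq, Real.fourier_real_eq,
    ← integral_tensorTriple]
  congr with p
  simp only [tensorTriple, dotTriple, Circle.smul_def, smul_eq_mul, neg_add, AddChar.map_add_eq_mul,
    Circle.coe_mul]
  ring

theorem integral_fourierChar_mul_tensorTriple_tripleRotation (f₁ f₂ f₃ : ℝ → ℂ) (l : ℝ)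
    (w : ℝ × ℝ × ℝ) :
    ∫ p, (𝐞 (-dotTriple p w) : ℂ) * tensorTriple f₁ f₂ f₃ (tripleRotation l p)
      = tensorTriple (𝓕 f₁) (𝓕 f₂) (𝓕 f₃) (tripleRotation l w) := by
  rw [← integral_fourierChar_mul_tensorTriple]
  have h := integral_comp_linearMap volume (L := tripleRotation l) (by simp [det_tripleRotation])
    fun p => (𝐞 (-dotTriple p (tripleRotation l w)) : ℂ) * tensorTriple f₁ f₂ f₃ p
  simpa [dotTriple_tripleRotation, det_tripleRotation] using h

theorem conj_eq_integral_fourierChar (f : SchwartzMap ℝ ℂ) (y : ℝ) :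
    conj (f y) = ∫ s, (𝐞 (-(y * s)) : ℂ) * conj (𝓕 (f : ℝ → ℂ) s) := by
  have h : f y = ∫ s, 𝐞 (y * s) • 𝓕 (f : ℝ → ℂ) s := by
    conv_lhs => rw [← FourierTransform.fourierInv_fourier_eq (F := SchwartzMap ℝ ℂ) f,
      fourierInv_coe, Real.fourierInv_eq]
    simp [fourier_coe]
  rw [h, ← integral_conj]
  congr with s
  rw [Circle.smul_def, smul_eq_mul, map_mul, AddChar.map_neg_eq_inv, Circle.coe_inv_eq_conj]

/-- The integrand of `T6` in the variables of integration `(λ, y, z)` where `y` and `z` are the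
arguments of `f₄` and `f₅`, without the Jacobian. -/
noncomputable def rotatedIntegrand (f₁ f₂ f₃ f₄ f₅ : ℝ → ℂ) (l : ℝ) (p : ℝ × ℝ × ℝ) : ℂ :=
  tensorTriple f₁ f₂ f₃ (tripleRotation l p) * conj (f₄ p.2.1 * f₅ p.2.2)

theorem continuous_rotatedIntegrand (f₁ f₂ f₃ f₄ f₅ : SchwartzMap ℝ ℂ) :
    Continuous fun r : ℝ × ℝ × ℝ × ℝ => rotatedIntegrand f₁ f₂ f₃ f₄ f₅ r.1 r.2 := by
  have h := (continuous_tensorTriple f₁ f₂ f₃).comp continuous_tripleRotation_uncurry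
  have h₄ := f₄.continuous
  have h₅ := f₅.continuous
  refine h.mul (Complex.continuous_conj.comp ?_)
  fun_prop

theorem integrable_conj_mul (f g : SchwartzMap ℝ ℂ) :
    Integrable fun q : ℝ × ℝ => conj (f q.1 * g q.2) :=
  (Complex.conjCLE.toContinuousLinearMap).integrable_comp
    ((f.integrable (μ := volume)).mul_prod (g.integrable (μ := volume)))

theorem integrable_rotatedIntegrand (f₁ f₂ f₃ f₄ f₅ : SchwartzMap ℝ ℂ) :
    ∃ C, ∀ l, Integrable (rotatedIntegrand f₁ f₂ f₃ f₄ f₅ l) ∧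
      ∫ p, ‖rotatedIntegrand f₁ f₂ f₃ f₄ f₅ l p‖ ≤ C := by
  obtain ⟨C₄, h₄, h₄'⟩ := f₄.exists_norm_le
  obtain ⟨C₅, h₅, h₅'⟩ := f₅.exists_norm_le
  refine ⟨(∫ p, ‖tensorTriple f₁ f₂ f₃ p‖) * (C₄ * C₅), fun l => ?_⟩
  have hdet : LinearMap.det (tripleRotation l) ≠ 0 := by simp [det_tripleRotation]
  have hb : ∀ p : ℝ × ℝ × ℝ, ‖conj (f₄ p.2.1 * f₅ p.2.2)‖ ≤ C₄ * C₅ := fun p => by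
    rw [RCLike.norm_conj, norm_mul]
    gcongr <;> simp [*]
  have hi := integrable_comp_linearMap volume hdet (integrable_tensorTriple f₁ f₂ f₃)
  have hK : Integrable (rotatedIntegrand f₁ f₂ f₃ f₄ f₅ l) := by
    refine hi.mul_bdd (c := C₄ * C₅) (Continuous.aestronglyMeasurable ?_) (.of_forall hb)
    have h₄ := f₄.continuous
    have h₅ := f₅.continuous
    exact Complex.continuous_conj.comp (by fun_prop)
  refine ⟨hK, ?_⟩
  have h := integral_comp_linearMap volume hdet fun p => ‖tensorTriple f₁ f₂ f₃ p‖
  simp only [det_tripleRotation, inv_one, abs_one, one_smul] at h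
  rw [← h, ← integral_mul_const]
  refine integral_mono hK.norm (hi.norm.mul_const _) fun p => ?_
  simp only [rotatedIntegrand, norm_mul (tensorTriple _ _ _ _)]
  gcongr
  exact hb p

theorem integrable_rotatedIntegrand_slice (f₁ f₂ f₃ f₄ f₅ : SchwartzMap ℝ ℂ) :
    ∃ C, ∀ l x, Integrable (fun q => rotatedIntegrand f₁ f₂ f₃ f₄ f₅ l (x, q)) ∧
      ∫ q, ‖rotatedIntegrand f₁ f₂ f₃ f₄ f₅ l (x, q)‖ ≤ C := by
  obtain ⟨C, hC⟩ := exists_norm_tensorTriple_le f₁ f₂ f₃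
  refine ⟨C * ∫ q : ℝ × ℝ, ‖conj (f₄ q.1 * f₅ q.2)‖, fun l x => ?_⟩
  have hi := integrable_conj_mul f₄ f₅
  have hK : Integrable (fun q => rotatedIntegrand f₁ f₂ f₃ f₄ f₅ l (x, q)) := by
    refine hi.bdd_mul (c := C) (Continuous.aestronglyMeasurable ?_) (.of_forall fun q => hC _)
    exact (continuous_tensorTriple f₁ f₂ f₃).comp
      (continuous_tripleRotation_uncurry.comp (by fun_prop : Continuous fun q : ℝ × ℝ => (l, x, q)))
  refine ⟨hK, ?_⟩
  rw [← integral_const_mul]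
  refine integral_mono hK.norm (hi.norm.const_mul _) fun q => ?_
  simp only [rotatedIntegrand, norm_mul (tensorTriple _ _ _ _)]
  gcongr
  exact hC _

theorem integrable_prod_of_integral_norm_le {α : Type*} [MeasurableSpace α] {μ : Measure α}
    [SFinite μ] {h : ℝ × α → ℂ} (hm : AEStronglyMeasurable h (volume.prod μ))
    (hi : ∀ l, Integrable (fun a => h (l, a)) μ) {C : ℝ}
    (hC : ∀ l : ℝ, ∫ a, ‖h (l, a)‖ ∂μ ≤ C * (l ^ 2 - l + 1)⁻¹) :
    Integrable h (volume.prod μ) := by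
  refine (integrable_prod_iff hm).2 ⟨.of_forall hi,
    (integrable_inv_sq_sub_self_add_one.const_mul C).mono' hm.norm.integral_prod_right'
      (.of_forall fun l => ?_)⟩
  rw [Real.norm_of_nonneg (integral_nonneg fun _ => norm_nonneg _)]
  exact hC l

theorem integral_comp_planeMap_add {G : Type*} [NormedAddCommGroup G] [NormedSpace ℝ G]
    (l : ℝ) (v : ℝ × ℝ) (g : ℝ × ℝ → G) :
    ∫ q, g (planeMap l q + v) = (l ^ 2 - l + 1)⁻¹ • ∫ q, g q := by
  have h := sq_sub_self_add_one_pos l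
  rw [integral_comp_linearMap volume (by simp [det_planeMap, h.ne', -neg_add_rev])
    fun q => g (q + v), integral_add_right_eq_self g v, det_planeMap, inv_neg, abs_neg,
    abs_of_pos (inv_pos.2 h)]

theorem T6_eq_integral_rotatedIntegrand (f₁ f₂ f₃ f₄ f₅ : SchwartzMap ℝ ℂ) (x : ℝ) :
    T6 f₁ f₂ f₃ f₄ f₅ x = ((3 / π ^ 2 : ℝ) : ℂ) *
      ∫ l : ℝ, (l ^ 2 - l + 1)⁻¹ • ∫ q, rotatedIntegrand f₁ f₂ f₃ f₄ f₅ l (x, q) := by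
  let h : ℝ × ℝ × ℝ → ℂ := fun r =>
    rotatedIntegrand f₁ f₂ f₃ f₄ f₅ r.1 (x, planeMap r.1 r.2 + (0, r.1 * x))
  have hT : T6 f₁ f₂ f₃ f₄ f₅ x = ((3 / π ^ 2 : ℝ) : ℂ) *
      ∫ p : ℝ × ℝ × ℝ, h (p.2.2, p.1, p.2.1) := by
    rw [T6]
    congr! 3 with p
    obtain ⟨b, s, l⟩ := p
    have hl := (sq_sub_self_add_one_pos l).ne'
    have hq : planeMap l (b, s) + (0, l * x) = (l * b + s, b + l * x + s - l * s) := by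
      ext <;> simp [planeMap]
      ring
    have hp : tripleRotation l (x, l * b + s, b + l * x + s - l * s)
        = (b + s, l * b + x, l * x + s - l * s) := by
      simp only [tripleRotation, LinearMap.coe_mk, AddHom.coe_mk, Prod.mk.injEq]
      refine ⟨?_, ?_, ?_⟩ <;> rw [div_eq_iff hl] <;> ring
    simp only [h, rotatedIntegrand, tensorTriple, hq, hp]
  obtain ⟨C, hC⟩ := integrable_rotatedIntegrand_slice f₁ f₂ f₃ f₄ f₅
  have hmap : Continuous fun r : ℝ × ℝ × ℝ => (r.1, x, planeMap r.1 r.2 + (0, r.1 * x)) := by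
    simp only [planeMap, LinearMap.coe_mk, AddHom.coe_mk]
    fun_prop
  have hcomp := (continuous_rotatedIntegrand f₁ f₂ f₃ f₄ f₅).comp hmap
  have hcont : Continuous h := hcomp
  have hinteg : Integrable h := by
    refine integrable_prod_of_integral_norm_le (C := C) hcont.aestronglyMeasurable
      (fun l => ?_) fun l => ?_
    · exact integrable_comp_linearMap volume (L := planeMap l)
        (by simp [det_planeMap, (sq_sub_self_add_one_pos l).ne', -neg_add_rev])
        (((hC l x).1).comp_add_right (0, l * x))
    · simp only [h]
      rw [integral_comp_planeMap_add l (0, l * x)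
        fun q => ‖rotatedIntegrand f₁ f₂ f₃ f₄ f₅ l (x, q)‖, smul_eq_mul, mul_comm]
      gcongr
      · exact (inv_pos.2 (sq_sub_self_add_one_pos l)).le
      · exact (hC l x).2
  have hmp : MeasurePreserving fun p : ℝ × ℝ × ℝ => (p.2.2, p.1, p.2.1) :=
    (Measure.measurePreserving_swap (μ := (volume : Measure (ℝ × ℝ)))
      (ν := (volume : Measure ℝ))).comp volume_preserving_prodAssoc.symm
  have hemb : MeasurableEmbedding fun p : ℝ × ℝ × ℝ => (p.2.2, p.1, p.2.1) :=
    (MeasurableEquiv.prodAssoc.symm.trans MeasurableEquiv.prodComm :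
      ℝ × ℝ × ℝ ≃ᵐ ℝ × ℝ × ℝ).measurableEmbedding
  rw [hT, hmp.integral_comp hemb h, Measure.volume_eq_prod, integral_prod _ hinteg]
  congr! 3 with l
  exact integral_comp_planeMap_add l (0, l * x)
    fun q => rotatedIntegrand f₁ f₂ f₃ f₄ f₅ l (x, q)

theorem integrable_fourierChar_mul_rotatedIntegrand (f₁ f₂ f₃ f₄ f₅ : SchwartzMap ℝ ℂ)
    (ξ l : ℝ) :
    Integrable fun p : ℝ × ℝ × ℝ =>
      (𝐞 (-(p.1 * ξ)) : ℂ) * rotatedIntegrand f₁ f₂ f₃ f₄ f₅ l p := by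
  obtain ⟨C, hC⟩ := integrable_rotatedIntegrand f₁ f₂ f₃ f₄ f₅
  exact (hC l).1.bdd_mul (c := 1) (Continuous.aestronglyMeasurable (by fun_prop))
    (.of_forall fun _ => (Circle.norm_coe _).le)

theorem integral_fourierChar_mul_rotatedIntegrand (f₁ f₂ f₃ f₄ f₅ : SchwartzMap ℝ ℂ) (ξ l : ℝ) :
    ∫ x, ∫ q, (𝐞 (-(x * ξ)) : ℂ) * rotatedIntegrand f₁ f₂ f₃ f₄ f₅ l (x, q)
      = ∫ q, rotatedIntegrand (𝓕 (f₁ : ℝ → ℂ)) (𝓕 (f₂ : ℝ → ℂ)) (𝓕 (f₃ : ℝ → ℂ))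
          (𝓕 (f₄ : ℝ → ℂ)) (𝓕 (f₅ : ℝ → ℂ)) l (ξ, q) := by
  have hinteg := integrable_fourierChar_mul_rotatedIntegrand f₁ f₂ f₃ f₄ f₅ ξ l
  have hconj : ∀ p : ℝ × ℝ × ℝ,
      (𝐞 (-(p.1 * ξ)) : ℂ) * rotatedIntegrand f₁ f₂ f₃ f₄ f₅ l p
        = ∫ w : ℝ × ℝ, (𝐞 (-dotTriple p (ξ, w)) : ℂ) *
            tensorTriple f₁ f₂ f₃ (tripleRotation l p) *
            conj (𝓕 (f₄ : ℝ → ℂ) w.1 * 𝓕 (f₅ : ℝ → ℂ) w.2) := fun p => by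
    rw [rotatedIntegrand, map_mul, conj_eq_integral_fourierChar, conj_eq_integral_fourierChar,
      ← integral_prod_mul, ← mul_assoc, ← integral_const_mul]
    congr with w
    simp only [dotTriple, neg_add, AddChar.map_add_eq_mul, Circle.coe_mul, map_mul]
    ring
  have hdet : LinearMap.det (tripleRotation l) ≠ 0 := by simp [det_tripleRotation]
  have hF := integrable_comp_linearMap volume hdet (integrable_tensorTriple f₁ f₂ f₃)
  have hswap : Integrable (fun r : (ℝ × ℝ × ℝ) × ℝ × ℝ =>
      (𝐞 (-dotTriple r.1 (ξ, r.2)) : ℂ) * tensorTriple f₁ f₂ f₃ (tripleRotation l r.1) *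
        conj (𝓕 (f₄ : ℝ → ℂ) r.2.1 * 𝓕 (f₅ : ℝ → ℂ) r.2.2)) (volume.prod volume) := by
    simp only [mul_assoc]
    refine (hF.mul_prod (integrable_conj_mul (𝓕 f₄) (𝓕 f₅))).bdd_mul (c := 1)
      (Continuous.aestronglyMeasurable ?_) (.of_forall fun _ => (Circle.norm_coe _).le)
    unfold dotTriple
    fun_prop
  rw [← integral_prod _ hinteg, ← Measure.volume_eq_prod]
  simp only [hconj]
  rw [integral_integral_swap hswap]
  simp only [integral_mul_const, integral_fourierChar_mul_tensorTriple_tripleRotation]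
  rfl

theorem fourier_T6 (f₁ f₂ f₃ f₄ f₅ : SchwartzMap ℝ ℂ) (ξ : ℝ) :
    𝓕 (T6 f₁ f₂ f₃ f₄ f₅) ξ = ((3 / π ^ 2 : ℝ) : ℂ) * ∫ l : ℝ, (l ^ 2 - l + 1)⁻¹ •
      ∫ x, ∫ q, (𝐞 (-(x * ξ)) : ℂ) * rotatedIntegrand f₁ f₂ f₃ f₄ f₅ l (x, q) := by
  let h : ℝ × ℝ × ℝ × ℝ → ℂ := fun r => (r.1 ^ 2 - r.1 + 1)⁻¹ •
    ((𝐞 (-(r.2.1 * ξ)) : ℂ) * rotatedIntegrand f₁ f₂ f₃ f₄ f₅ r.1 r.2)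
  obtain ⟨C, hC⟩ := integrable_rotatedIntegrand f₁ f₂ f₃ f₄ f₅
  have hinteg : Integrable h := by
    refine integrable_prod_of_integral_norm_le (C := C) (Continuous.aestronglyMeasurable ?_)
      (fun l => ?_) fun l => ?_
    · refine Continuous.smul (Continuous.inv₀ (by fun_prop)
        fun r : ℝ × ℝ × ℝ × ℝ => (sq_sub_self_add_one_pos r.1).ne') (Continuous.mul (by fun_prop) ?_)
      exact continuous_rotatedIntegrand f₁ f₂ f₃ f₄ f₅
    · exact (integrable_fourierChar_mul_rotatedIntegrand f₁ f₂ f₃ f₄ f₅ ξ l).smul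
        (l ^ 2 - l + 1)⁻¹
    · have hl := (inv_pos.2 (sq_sub_self_add_one_pos l)).le
      simp only [h, norm_smul, norm_mul, Circle.norm_coe, one_mul, Real.norm_of_nonneg hl]
      rw [integral_const_mul, mul_comm]
      gcongr
      exact (hC l).2
  have hswapInt : Integrable (Function.uncurry fun l x => ∫ q, h (l, x, q))
      (volume.prod volume) :=
    Integrable.integral_prod_left (μ := volume) (ν := volume)
      (f := fun r : (ℝ × ℝ) × ℝ × ℝ => h (r.1.1, r.1.2, r.2))
      ((volume_preserving_prodAssoc (α₁ := ℝ) (β₁ := ℝ) (γ₁ := ℝ × ℝ)).integrable_comp_of_integrable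
        hinteg)
  have hswap := integral_integral_swap hswapInt
  simp only [h, integral_smul] at hswap
  rw [hswap, Real.fourier_real_eq, ← integral_const_mul]
  congr with x
  rw [T6_eq_integral_rotatedIntegrand, Circle.smul_def, smul_eq_mul, mul_left_comm,
    ← integral_const_mul]
  simp only [integral_const_mul, mul_smul_comm]

theorem stmt8 (f₁ f₂ f₃ f₄ f₅ : SchwartzMap ℝ ℂ) (ξ : ℝ) :
    𝓕 (T6 f₁ f₂ f₃ f₄ f₅) ξ
      = T6 (𝓕 (f₁ : ℝ → ℂ)) (𝓕 (f₂ : ℝ → ℂ)) (𝓕 (f₃ : ℝ → ℂ))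
          (𝓕 (f₄ : ℝ → ℂ)) (𝓕 (f₅ : ℝ → ℂ)) ξ := by
  rw [fourier_T6]
  simp only [integral_fourierChar_mul_rotatedIntegrand]
  exact (T6_eq_integral_rotatedIntegrand (𝓕 f₁) (𝓕 f₂) (𝓕 f₃) (𝓕 f₄) (𝓕 f₅) ξ).symm
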